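/- Let η : Set Σ → Set Σ be the attribute-independent partitioning input observation determined by equivalence relations ≈_H on H and ≈_L on L, i.e., η(X) := ⋃_{(h,l) ∈ X} [h]_{≈_H} ×ˢ [l]_{≈_L}; let ρ : Set Σ → Set Σ observe only public data, ρ(Y) := Set.univ ×ˢ ρ_∘(Y°), with ρ_∘ a partitioning upper closure operator on Set L; and let φ_* on Set H and φ_∘ on Set L be partitioning upper closure operators with declassification abstraction 𝓗_φ(X) := ⋃_{o ∈ X°} φ_*({h | (h, o) ∈ X}) ×ˢ φ_∘({o}). Then the program satisfies declassified abstract non-interference for a static attacker — ∀ x₁ x₂ : Σ, φ_*({x₁.1}) = φ_*({x₂.1}) → φ_∘({x₁.2}) = φ_∘({x₂.2}) → ρ(F(η({x₁}))) = ρ(F(η({x₂}))) — if and only if ∀ X : Set Σ, 𝓗((ρ ∘ F ∘ η)(𝓗_φ X)) = 𝓗((ρ ∘ F ∘ η)(X)). -/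

import Mathlib

/-- The abstraction `𝓗` pairing each observable value occurring in `X`
with all internal values. -/
def HH {H L : Type*} (X : Set (H × L)) : Set (H × L) :=
  Set.univ ×ˢ (Prod.snd '' X)

theorem HH_univ_prod {H L : Type*} (A : Set L) :
    HH (Set.univ ×ˢ A : Set (H × L)) = Set.univ ×ˢ A := by
  ext ⟨h, l⟩
  simp only [HH, Set.mem_prod, Set.mem_univ, true_and, Set.mem_image, Prod.exists,
    exists_eq_right]
  exact ⟨fun ⟨_, hl⟩ => hl, fun hl => ⟨h, hl⟩⟩

/-- Two points have the same closure under a partitioning operator iff they are equivalent. -/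
theorem partitioning_singleton_eq_iff {A : Type*} (r : Setoid A) (φ : Set A → Set A)
    (hφ : ∀ S : Set A, φ S = {b | ∃ a ∈ S, r.r b a}) (a b : A) :
    φ {a} = φ {b} ↔ r.r a b := by
  simp only [hφ, Set.mem_singleton_iff, exists_eq_left, Set.ext_iff, Set.mem_ofPred_eq]
  exact ⟨fun h => (h a).1 (r.refl a),
    fun h c => ⟨fun hc => r.trans hc h, fun hc => r.trans hc (r.symm h)⟩⟩

/-- Declassified abstract non-interference for a static attacker (partitioning
input observation `η`, public-output observation `ρ`, and partitioning
declassification ucos `φ_*`, `φ_∘` with abstraction `𝓗_φ`) holds iff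
`∀ X, 𝓗((ρ ∘ F ∘ η)(𝓗_φ X)) = 𝓗((ρ ∘ F ∘ η)(X))`. -/
theorem dani_static_iff {H L : Type*} (f : H × L → H × L)
    (rH : Setoid H) (rL : Setoid L)
    (η : Set (H × L) → Set (H × L))
    (hη : ∀ X : Set (H × L),
      η X = ⋃ x ∈ X, ({h | rH.r h x.1} ×ˢ {l | rL.r l x.2} : Set (H × L)))
    (rρ : Setoid L)
    (ρ₀ : Set L → Set L) (hρ₀ : ∀ S : Set L, ρ₀ S = {b | ∃ a ∈ S, rρ.r b a})
    (ρ : Set (H × L) → Set (H × L))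
    (hρ : ∀ Y : Set (H × L), ρ Y = Set.univ ×ˢ ρ₀ (Prod.snd '' Y))
    (rφH : Setoid H) (φs : Set H → Set H)
    (hφs : ∀ S : Set H, φs S = {b | ∃ a ∈ S, rφH.r b a})
    (rφL : Setoid L) (φo : Set L → Set L)
    (hφo : ∀ S : Set L, φo S = {b | ∃ a ∈ S, rφL.r b a})
    (Hφ : Set (H × L) → Set (H × L))
    (hHφ : ∀ X : Set (H × L),
      Hφ X = ⋃ o ∈ Prod.snd '' X, (φs {h | (h, o) ∈ X} ×ˢ φo {o} : Set (H × L))) :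
    (∀ x₁ x₂ : H × L, φs {x₁.1} = φs {x₂.1} → φo {x₁.2} = φo {x₂.2} →
        ρ (f '' η {x₁}) = ρ (f '' η {x₂})) ↔
      (∀ X : Set (H × L), HH (ρ (f '' η (Hφ X))) = HH (ρ (f '' η X))) := by
  have hHH : ∀ Y, HH (ρ Y) = ρ Y := fun Y => by rw [hρ, HH_univ_prod]
  have hη_iUnion : ∀ X, η X = ⋃ x ∈ X, η {x} := fun X => by
    rw [hη]
    exact Set.iUnion₂_congr fun x _ => by rw [hη, Set.biUnion_singleton]
  have mem_obs : ∀ X p, p ∈ ρ (f '' η X) ↔ ∃ x ∈ X, p ∈ ρ (f '' η {x}) := by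
    intro X p
    rw [hη_iUnion X]
    simp only [hρ, hρ₀, Set.mem_prod, Set.mem_univ, true_and, Set.mem_ofPred_eq,
      Set.image_iUnion, Set.mem_iUnion]
    constructor
    · rintro ⟨a, ⟨x, hx, ha⟩, hr⟩
      exact ⟨x, hx, a, ha, hr⟩
    · rintro ⟨x, hx, a, ha, hr⟩
      exact ⟨a, ⟨x, hx, ha⟩, hr⟩
  have mem_Hφ : ∀ X y, y ∈ Hφ X ↔ ∃ x ∈ X, rφH.r y.1 x.1 ∧ rφL.r y.2 x.2 := by
    intro X y
    simp only [hHφ, hφs, hφo, Set.mem_iUnion, Set.mem_prod, Set.mem_ofPred_eq,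
      Set.mem_singleton_iff, exists_eq_left]
    constructor
    · rintro ⟨o, -, ⟨h, hh, hr⟩, hl⟩
      exact ⟨(h, o), hh, hr, hl⟩
    · rintro ⟨x, hx, hr, hl⟩
      exact ⟨x.2, ⟨x, hx, rfl⟩, ⟨x.1, hx, hr⟩, hl⟩
  simp only [hHH, partitioning_singleton_eq_iff rφH φs hφs,
    partitioning_singleton_eq_iff rφL φo hφo]
  constructor
  · intro hni X
    ext p
    rw [mem_obs, mem_obs X]
    constructor
    · rintro ⟨y, hy, hp⟩
      obtain ⟨x, hx, hH, hL⟩ := (mem_Hφ X y).1 hy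
      exact ⟨x, hx, hni y x hH hL ▸ hp⟩
    · rintro ⟨x, hx, hp⟩
      exact ⟨x, (mem_Hφ X x).2 ⟨x, hx, rφH.refl _, rφL.refl _⟩, hp⟩
  · intro hc x₁ x₂ hH hL
    have heq : Hφ {x₁} = Hφ {x₂} := by
      ext y
      simp only [mem_Hφ, Set.mem_singleton_iff, exists_eq_left]
      exact ⟨fun h => ⟨rφH.trans h.1 hH, rφL.trans h.2 hL⟩,
        fun h => ⟨rφH.trans h.1 (rφH.symm hH), rφL.trans h.2 (rφL.symm hL)⟩⟩
    rw [← hc {x₁}, ← hc {x₂}, heq]
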